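/- If a directed graph D on n vertices has no directed cycle of length k (for fixed k ≥ 2), then D has at most n(n-1)/2 + (k-2)n/2 arcs. -/

import Mathlib

/-- The arcs of `A` contain a directed cycle of length `k` through vertices of `S`. -/
def HasCycleIn {V : Type*} (A : Finset (V × V)) (k : ℕ) (S : Finset V) : Prop :=
  ∃ c : ZMod k → V, Function.Injective c ∧ (∀ i, c i ∈ S) ∧ ∀ i, (c i, c (i + 1)) ∈ A

theorem HasCycleIn.mono {V : Type*} {A : Finset (V × V)} {k : ℕ} {S T : Finset V}
    (h : HasCycleIn A k S) (hST : S ⊆ T) : HasCycleIn A k T := by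
  obtain ⟨c, hc, hS, hA⟩ := h
  exact ⟨c, hc, fun i => hST (hS i), hA⟩

/-- The arc indicator. -/
def arcInd {V : Type*} [DecidableEq V] (A : Finset (V × V)) (u w : V) : ℕ :=
  if (u, w) ∈ A then 1 else 0

theorem arcInd_le_one {V : Type*} [DecidableEq V] (A : Finset (V × V)) (u w : V) :
    arcInd A u w ≤ 1 := by
  unfold arcInd
  split_ifs <;> simp

theorem arcInd_le_of_loopless {V : Type*} [DecidableEq V] {A : Finset (V × V)}
    (hloop : ∀ v, (v, v) ∉ A) (u w : V) : arcInd A u w ≤ if u = w then 0 else 1 := by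
  by_cases h : u = w
  · subst h
    simp [arcInd, hloop]
  · simpa [h] using arcInd_le_one A u w

theorem sum_sum_ne {V : Type*} [DecidableEq V] (S : Finset V) :
    ∑ u ∈ S, ∑ w ∈ S, (if u = w then 0 else 1) = S.card * (S.card - 1) := by
  refine Finset.sum_const_nat fun u hu => ?_
  rw [← Finset.card_erase_of_mem hu, Finset.card_eq_sum_ones, ← Finset.filter_ne,
    Finset.sum_filter]
  exact Finset.sum_congr rfl fun w _ => by by_cases h : u = w <;> simp [h]

/-- A cycle avoiding `v` extends by inserting `v` between two consecutive vertices. -/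
theorem hasCycleIn_insert {V : Type*} {A : Finset (V × V)} {m : ℕ} {S : Finset V}
    {c : Fin (m + 1) → V} (hc : Function.Injective c) (hS : ∀ i, c i ∈ S)
    (hA : ∀ i, (c i, c (i + 1)) ∈ A) {v : V} (hvS : v ∈ S) (hv : ∀ i, c i ≠ v)
    {i : Fin (m + 1)} (hin : (c i, v) ∈ A) (hout : (v, c (i + 1)) ∈ A) :
    HasCycleIn A (m + 2) S := by
  let d : Fin (m + 1) → V := fun j => c (i + 1 + j)
  have hd : Function.Injective d := fun a b h => add_left_cancel (hc h)
  have hlast : (i + 1 + Fin.last m : Fin (m + 1)) = i := by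
    have h : (1 + Fin.last m : Fin (m + 1)) = 0 :=
      (add_comm _ _).trans (Fin.last_add_one m)
    rw [add_assoc, h, add_zero]
  refine ⟨(Fin.cons v d : Fin (m + 2) → V), ?_, ?_, ?_⟩
  · refine Fin.cons_injective_iff.2 ⟨?_, hd⟩
    rintro ⟨j, hj⟩
    exact hv _ hj
  · intro j
    refine Fin.cases ?_ (fun a => ?_) j
    · exact hvS
    · exact hS _
  · change ∀ j : Fin (m + 2), ((Fin.cons v d : Fin (m + 2) → V) j,
      (Fin.cons v d : Fin (m + 2) → V) (j + 1)) ∈ A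
    intro j
    refine Fin.cases ?_ (fun a => ?_) j
    · have h : (0 : Fin (m + 2)) + 1 = Fin.succ 0 := by simp
      rw [h, Fin.cons_zero, Fin.cons_succ]
      have h0 : d 0 = c (i + 1) := congrArg c (add_zero (i + 1))
      rwa [h0]
    · induction a using Fin.lastCases with
      | last =>
        rw [Fin.succ_last, Fin.last_add_one, ← Fin.succ_last, Fin.cons_succ, Fin.cons_zero]
        have h0 : d (Fin.last m) = c i := congrArg c hlast
        rwa [h0]
      | cast b =>
        have h : (b.castSucc.succ : Fin (m + 2)) + 1 = (b.castSucc + 1).succ := by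
          rw [Fin.coeSucc_eq_succ, Fin.succ_castSucc, Fin.coeSucc_eq_succ]
        rw [h, Fin.cons_succ, Fin.cons_succ]
        have h1 : d (b.castSucc + 1) = c (i + 1 + b.castSucc + 1) :=
          congrArg c (add_assoc (i + 1) (b.castSucc : Fin (m + 1)) 1).symm
        rw [h1]
        exact hA _

theorem two_mul_sum_arcInd_le_of_not_hasCycleIn {V : Type*} [DecidableEq V]
    (A : Finset (V × V)) (hloop : ∀ v, (v, v) ∉ A) (m : ℕ) (S : Finset V)
    (h : ¬ HasCycleIn A (m + 2) S) :
    2 * ∑ u ∈ S, ∑ w ∈ S, arcInd A u w ≤ S.card * (S.card - 1) + m * S.card := by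
  induction m generalizing S with
  | zero =>
    rw [two_mul]
    nth_rewrite 2 [Finset.sum_comm]
    rw [← Finset.sum_add_distrib, ← sum_sum_ne, zero_mul, add_zero]
    refine Finset.sum_le_sum fun u hu => ?_
    rw [← Finset.sum_add_distrib]
    refine Finset.sum_le_sum fun w hw => ?_
    by_cases huw : u = w
    · subst huw
      simp [arcInd, hloop]
    · by_cases h1 : (u, w) ∈ A
      · by_cases h2 : (w, u) ∈ A
        · refine absurd ⟨(![u, w] : Fin 2 → V), ?_, ?_, ?_⟩ h
          · intro a b hab
            change Fin 2 at a b
            fin_cases a <;> fin_cases b <;> first | rfl | simp_all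
          · intro a
            change Fin 2 at a
            fin_cases a <;> simp [hu, hw]
          · intro a
            change Fin 2 at a
            fin_cases a
            · exact h1
            · exact h2
        · simp [arcInd, huw, h1, h2]
      · simpa [arcInd, huw, h1] using arcInd_le_one A w u
  | succ m ihm =>
    induction S using Finset.strongInduction with
    | H S ihS =>
    by_cases hC : HasCycleIn A (m + 2) S
    swap
    · exact (ihm S hC).trans (by gcongr; simp)
    obtain ⟨c, hc, hcS, hcA⟩ := hC
    set C : Finset V := Finset.univ.image c with hCdef
    have hCS : C ⊆ S := by
      intro x hx
      obtain ⟨i, -, rfl⟩ := Finset.mem_image.1 hx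
      exact hcS i
    have hcard : C.card = m + 2 := by
      rw [hCdef, Finset.card_image_of_injective _ hc, Finset.card_univ, ZMod.card]
    have hT : S \ C ⊂ S := Finset.sdiff_ssubset hCS (Finset.card_pos.1 (by omega))
    have hrec := ihS _ hT fun h' => h (h'.mono hT.subset)
    have hST : S.card = (S \ C).card + (m + 2) := by
      rw [← hcard, Finset.card_sdiff_add_card_eq_card hCS]
    have hsplit : ∀ f : V → ℕ, ∑ u ∈ S, f u = ∑ u ∈ S \ C, f u + ∑ u ∈ C, f u :=
      fun f => (Finset.sum_sdiff hCS).symm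
    have hCC : ∑ u ∈ C, ∑ w ∈ C, arcInd A u w ≤ (m + 2) * (m + 1) := by
      have := sum_sum_ne C
      rw [hcard] at this
      rw [show m + 1 = m + 2 - 1 from rfl, ← this]
      exact Finset.sum_le_sum fun u _ => Finset.sum_le_sum fun w _ =>
        arcInd_le_of_loopless hloop u w
    have hTC : ∑ u ∈ S \ C, ∑ w ∈ C, arcInd A u w + ∑ u ∈ C, ∑ w ∈ S \ C, arcInd A u w
        ≤ (S \ C).card * (m + 2) := by
      nth_rewrite 2 [Finset.sum_comm]
      rw [← Finset.sum_add_distrib, ← smul_eq_mul]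
      refine Finset.sum_le_card_nsmul _ _ _ fun v hv => ?_
      obtain ⟨hvS, hvC⟩ := Finset.mem_sdiff.1 hv
      have hvc : ∀ i, c i ≠ v := fun i hi =>
        hvC (hi ▸ Finset.mem_image_of_mem c (Finset.mem_univ i))
      rw [hCdef, Finset.sum_image hc.injOn, Finset.sum_image hc.injOn,
        ← Equiv.sum_comp (Equiv.addRight (1 : ZMod (m + 2))), ← Finset.sum_add_distrib]
      refine (Finset.sum_le_card_nsmul _ _ 1 fun i _ => ?_).trans
        (by rw [Finset.card_univ, ZMod.card, smul_eq_mul, mul_one])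
      by_cases h1 : (c i, v) ∈ A
      · by_cases h2 : (v, c (i + 1)) ∈ A
        · exact absurd (hasCycleIn_insert hc hcS hcA hvS hvc h1 h2) h
        · simp [arcInd, h1, h2]
      · rw [show arcInd A (c i) v = 0 by simp [arcInd, h1], add_zero]
        exact arcInd_le_one A v (c (i + 1))
    rw [hsplit, Finset.sum_congr rfl fun u _ => hsplit _,
      Finset.sum_congr (rfl : C = C) fun u _ => hsplit _, Finset.sum_add_distrib,
      Finset.sum_add_distrib, hST]
    generalize (S \ C).card = t at *
    rcases t with _ | t
    · simp only [Nat.zero_add, Nat.add_succ_sub_one] at *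
      nlinarith
    · simp only [Nat.add_sub_cancel, Nat.add_succ_sub_one] at *
      nlinarith

/-- **Häggkvist–Thomassen bound.** If a loopless directed graph on `n` vertices
(2-cycles allowed) has no directed cycle of length `k` (for `k ≥ 2`), then it has
at most `n(n-1)/2 + (k-2)n/2` arcs. -/
theorem stmt_0 (n k : ℕ) (hk : 2 ≤ k) (A : Finset (Fin n × Fin n))
    (hloop : ∀ v : Fin n, (v, v) ∉ A)
    (hnocycle : ¬ ∃ v : ZMod k → Fin n, Function.Injective v ∧
      ∀ i : ZMod k, (v i, v (i + 1)) ∈ A) :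
    2 * A.card ≤ n * (n - 1) + (k - 2) * n := by
  obtain ⟨m, rfl⟩ := Nat.exists_eq_add_of_le' hk
  have h := two_mul_sum_arcInd_le_of_not_hasCycleIn A hloop m Finset.univ
    fun ⟨c, hc, _, hcA⟩ => hnocycle ⟨c, hc, hcA⟩
  rw [← Fintype.sum_prod_type'] at h
  simpa [arcInd] using h
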